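/- arXiv:2104.11630 — 2 statements merged into one kernel-verified Lean document; each statement's English description precedes it below -/
import Mathlib

section
/- The function g₁(r) = g(r)/r² is strictly decreasing on the interval (0,1). -/
open Real Set Filter Topology

/-- The complete elliptic integral of the first kind. -/
noncomputable def K (r : ℝ) : ℝ :=
  ∫ t in (0:ℝ)..(π/2), (1 - r^2 * Real.sin t ^ 2) ^ (-(1:ℝ)/2)

/-- `lam = 8/5 - log 4`. -/
noncomputable def lam : ℝ := 8/5 - Real.log 4

noncomputable def g (r : ℝ) : ℝ :=
  (lam * r^2 + K r) * (16 + (5*π - 16) * r^2) - (π/2) * (16 - 5 * Real.log (1 - r^2))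

noncomputable def g₁ (r : ℝ) : ℝ := g r / r^2

noncomputable def pc (n : ℕ) : ℝ := ∏ i ∈ Finset.range n, (2 * (i : ℝ) + 1) / (2 * i + 2)

theorem pc_succ (n : ℕ) : pc (n + 1) = pc n * ((2 * (n : ℝ) + 1) / (2 * n + 2)) := by
  simp only [pc, Finset.prod_range_succ]

theorem pc_zero : pc 0 = 1 := by simp [pc]

theorem pc_pos (n : ℕ) : 0 < pc n := by
  unfold pc
  exact Finset.prod_pos fun i _ => by positivity

theorem pc_W (n : ℕ) : pc n ^ 2 * (2 * n + 1) * Real.Wallis.W n = 1 := by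
  induction n with
  | zero => simp [pc, Real.Wallis.W]
  | succ n ih =>
    rw [pc_succ, Real.Wallis.W_succ]
    refine Eq.trans ?_ ih
    push_cast
    field_simp
    ring

theorem pc_bound (n : ℕ) : pc n ^ 2 * (n + 1 / 4) ≤ 1 / π := by
  have hmono : Monotone (fun n : ℕ => pc n ^ 2 * ((n : ℝ) + 1 / 4)) := by
    apply monotone_nat_of_le_succ
    intro n
    rw [pc_succ]
    push_cast
    have hp := pc_pos n
    rw [mul_pow, mul_assoc]
    apply mul_le_mul_of_nonneg_left _ (by positivity)
    rw [div_pow, div_mul_eq_mul_div, le_div_iff₀ (by positivity)]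
    nlinarith
  have hlim : Tendsto (fun n : ℕ => pc n ^ 2 * ((n : ℝ) + 1 / 4)) atTop (𝓝 (1 / π)) := by
    have h1 : Tendsto (fun n : ℕ => (1 / 2 - (1 / 4) * (1 / (2 * (n : ℝ) + 1))) / Real.Wallis.W n)
        atTop (𝓝 ((1 / 2 - (1 / 4) * 0) / (π / 2))) := by
      apply Tendsto.div _ Real.Wallis.tendsto_W_nhds_pi_div_two (by positivity)
      apply Tendsto.sub tendsto_const_nhds
      apply Tendsto.mul tendsto_const_nhds
      apply Tendsto.div_atTop tendsto_const_nhds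
      apply tendsto_atTop_add_const_right
      exact Tendsto.const_mul_atTop (by norm_num) tendsto_natCast_atTop_atTop
    have e : ((1 / 2 - (1 / 4) * 0) / (π / 2) : ℝ) = 1 / π := by
      field_simp
      norm_num
    rw [e] at h1
    refine h1.congr fun n => ?_
    have hW := Real.Wallis.W_pos n
    have := pc_W n
    rw [div_eq_iff hW.ne']
    have h2 : (0 : ℝ) < 2 * n + 1 := by positivity
    have : pc n ^ 2 * Real.Wallis.W n = 1 / (2 * n + 1) := by
      rw [eq_div_iff h2.ne']; linarith
    calc _ = ((n : ℝ) + 1 / 4) * (1 / (2 * n + 1)) := by field_simp; ring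
      _ = _ := by rw [← this]; ring
  exact hmono.ge_of_tendsto hlim n

theorem multichoose_half (n : ℕ) : Ring.multichoose (1 / 2 : ℝ) n = pc n := by
  have h := Ring.factorial_nsmul_multichoose_eq_ascPochhammer (1 / 2 : ℝ) n
  rw [Polynomial.ascPochhammer_smeval_eq_eval] at h
  have h2 : (ascPochhammer ℝ n).eval (1 / 2 : ℝ) = n.factorial • pc n := by
    clear h
    induction n with
    | zero => simp [pc]
    | succ n ih =>
      rw [ascPochhammer_succ_eval, ih, pc_succ, Nat.factorial_succ]
      simp only [nsmul_eq_mul]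
      push_cast
      field_simp
      ring
  rw [h2] at h
  exact (nsmul_right_inj (Nat.factorial_ne_zero n)).1 h

theorem hasSum_half {y : ℝ} (hy : |y| < 1) :
    HasSum (fun n => pc n * y ^ n) ((1 - y) ^ (-(1 : ℝ) / 2)) := by
  have h := (Real.one_div_one_sub_rpow_hasFPowerSeriesOnBall_zero (1 / 2)).hasSum (y := y)
    (by simpa [enorm_eq_nnnorm, ← NNReal.coe_lt_coe] using hy)
  simp only [zero_add, FormalMultilinearSeries.ofScalars_apply_eq, ← Ring.multichoose_eq,
    multichoose_half, smul_eq_mul] at h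
  have e : 1 / (1 - y) ^ (1 / 2 : ℝ) = (1 - y) ^ (-(1 : ℝ) / 2) := by
    rw [neg_div, Real.rpow_neg (by linarith [(abs_lt.1 hy).2]), one_div]
  rw [e] at h
  exact h

theorem int_sin (n : ℕ) : ∫ t in (0:ℝ)..(π/2), Real.sin t ^ (2 * n) = π / 2 * pc n := by
  induction n with
  | zero => simp [pc]
  | succ n ih =>
    rw [mul_add, mul_one, integral_sin_pow, ih, pc_succ]
    simp
    field_simp

theorem hasSum_K {r : ℝ} (h0 : 0 < r) (h1 : r < 1) :
    HasSum (fun n => π / 2 * (pc n ^ 2 * (r ^ 2) ^ n)) (K r) := by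
  have hx : |r ^ 2| < 1 := by rw [abs_of_nonneg (by positivity)]; nlinarith
  have key := intervalIntegral.hasSum_integral_of_dominated_convergence
    (μ := MeasureTheory.volume) (a := 0) (b := π / 2)
    (F := fun n t => pc n * (r ^ 2 * Real.sin t ^ 2) ^ n)
    (f := fun t => (1 - r^2 * Real.sin t ^ 2) ^ (-(1:ℝ)/2))
    (fun n _ => pc n * (r ^ 2) ^ n)
    (fun n => (by fun_prop : Continuous fun t => pc n * (r ^ 2 * Real.sin t ^ 2) ^ n).aestronglyMeasurable)
    (fun n => by
      filter_upwards with t _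
      have := pc_pos n
      rw [Real.norm_eq_abs, abs_of_nonneg (by positivity)]
      gcongr
      nlinarith [Real.sin_sq_le_one t, sq_nonneg r])
    (by
      filter_upwards with t _
      exact (hasSum_half hx).summable)
    (by simp)
    (by
      filter_upwards with t _
      apply hasSum_half
      rw [abs_of_nonneg (by positivity)]
      nlinarith [Real.sin_sq_le_one t, sq_nonneg r, abs_lt.1 hx])
  unfold K
  refine key.congr_fun ?_ 
  intro n
  have e : ∀ t, pc n * (r ^ 2 * Real.sin t ^ 2) ^ n = (pc n * (r ^ 2) ^ n) * Real.sin t ^ (2 * n) := by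
    intro t; rw [mul_pow, pow_mul (Real.sin t)]; ring
  simp only [e]
  rw [intervalIntegral.integral_const_mul, int_sin]
  ring

noncomputable def bc (n : ℕ) : ℝ := 16 * pc (n + 1) ^ 2 + (5 * π - 16) * pc n ^ 2 - 5 / (n + 1)

theorem bc_nonpos (n : ℕ) : bc n ≤ 0 := by
  unfold bc
  have hb := pc_bound n
  have hπ := Real.pi_lt_d2
  have hπ0 := Real.pi_pos
  have hn : (0 : ℝ) ≤ n := n.cast_nonneg
  have hA : pc n ^ 2 ≤ 1 / (π * (n + 1 / 4)) := by
    rw [← div_div, le_div_iff₀ (by positivity)]; exact hb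
  have e : 16 * pc (n + 1) ^ 2 + (5 * π - 16) * pc n ^ 2
      = pc n ^ 2 * (5 * π - 16 / (n + 1) + 4 / (n + 1) ^ 2) := by
    rw [pc_succ]; field_simp; ring
  have e2 : 5 * π - 16 / ((n : ℝ) + 1) + 4 / (n + 1) ^ 2
      = (5 * π * (n + 1) ^ 2 - 16 * (n + 1) + 4) / (n + 1) ^ 2 := by field_simp
  have hpi3 := Real.pi_gt_three
  have hpos : 0 ≤ 5 * π * ((n : ℝ) + 1) ^ 2 - 16 * (n + 1) + 4 := by nlinarith
  rw [e, e2, sub_nonpos]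
  refine (mul_le_mul_of_nonneg_right hA (by positivity)).trans ?_
  rw [div_mul_div_comm, div_le_div_iff₀ (by positivity) (by positivity)]
  have : (5 * π * ((n : ℝ) + 1) ^ 2 - 16 * (n + 1) + 4) ≤ 5 * π * (n + 1 / 4) * (n + 1) := by
    nlinarith
  nlinarith [mul_le_mul_of_nonneg_right this (show (0 : ℝ) ≤ n + 1 by positivity)]

theorem hasSum_g {r : ℝ} (h0 : 0 < r) (h1 : r < 1) :
    HasSum (fun n => π / 2 * bc n * (r ^ 2) ^ n) (g₁ r - lam * (16 + (5 * π - 16) * r ^ 2)) := by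
  have hx : |r ^ 2| < 1 := by rw [abs_of_nonneg (by positivity)]; nlinarith
  have hK := hasSum_K h0 h1
  have hK1 := (hasSum_nat_add_iff' 1).2 hK
  have hl := hasSum_pow_div_log_of_abs_lt_one hx
  have := (((hK1.mul_left 16).add (hK.mul_left ((5 * π - 16) * r ^ 2))).sub
    (hl.mul_left (5 * π / 2))).div_const (r ^ 2)
  have hr : r ≠ 0 := h0.ne'
  have e1 : g₁ r - lam * (16 + (5 * π - 16) * r ^ 2) =
      (16 * (K r - ∑ i ∈ Finset.range 1, π / 2 * (pc i ^ 2 * (r ^ 2) ^ i))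
        + (5 * π - 16) * r ^ 2 * K r - 5 * π / 2 * -log (1 - r ^ 2)) / r ^ 2 := by
    unfold g₁ g
    simp only [Finset.sum_range_one, pc_zero, pow_zero]
    field_simp
    ring
  rw [e1]
  refine this.congr_fun fun n => ?_
  unfold bc
  field_simp
  ring

theorem g₁_strictAntiOn : StrictAntiOn g₁ (Ioo (0:ℝ) 1) := by
  intro r hr s hs hrs
  have hg := hasSum_le (fun n => ?_) (hasSum_g hs.1 hs.2) (hasSum_g hr.1 hr.2)
  · have hlam : 0 < lam := by
      have : Real.log 4 = 2 * Real.log 2 := by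
        rw [show (4 : ℝ) = 2 ^ 2 by norm_num, Real.log_pow]; norm_num
      unfold lam
      linarith [Real.log_two_lt_d9]
    have hc : 0 < 16 - 5 * π := by linarith [Real.pi_lt_d2]
    have hsq : 0 < s ^ 2 - r ^ 2 := by nlinarith [hr.1]
    nlinarith [mul_pos (mul_pos hlam hc) hsq]
  · have hb : π / 2 * bc n ≤ 0 := mul_nonpos_of_nonneg_of_nonpos (by positivity) (bc_nonpos n)
    apply mul_le_mul_of_nonpos_left _ hb
    have := hr.1
    gcongr
end

section
/- The function g₁(r) = g(r)/r² is strictly concave on the interval (0,1). -/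
open Real Set Filter Topology

noncomputable def cc : ℕ → ℝ
  | 0 => 1
  | (n+1) => cc n * ((2*n+1)/(2*n+2))

lemma cc_pos (n : ℕ) : 0 < cc n := by
  induction n with
  | zero => simp [cc]
  | succ n ih => rw [cc]; positivity

lemma cc_le (n : ℕ) : cc n ≤ 1 := by
  induction n with
  | zero => simp [cc]
  | succ n ih =>
    rw [cc]
    have : ((2*n+1)/(2*n+2) : ℝ) ≤ 1 := by
      rw [div_le_one (by positivity)]; linarith
    exact mul_le_one₀ ih (by positivity) this

lemma cc_eq (n : ℕ) : Ring.choose ((1/2:ℝ) + n - 1) n = cc n := by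
  rw [← Ring.multichoose_eq]
  have key : ∀ n : ℕ, (n.factorial : ℝ) * Ring.multichoose (1/2:ℝ) n
      = (ascPochhammer ℝ n).eval (1/2) := by
    intro n
    have := Ring.factorial_nsmul_multichoose_eq_ascPochhammer (1/2:ℝ) n
    rw [nsmul_eq_mul] at this
    rw [this, ← ascPochhammer_map (algebraMap ℕ ℝ), Polynomial.eval_map]
    rw [Polynomial.smeval_eq_sum, Polynomial.eval₂_eq_sum]
    simp [Polynomial.sum, Polynomial.smul_pow]
  induction n with
  | zero => simp [cc]
  | succ n ih =>
    have h1 := key n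
    have h2 := key (n+1)
    rw [ascPochhammer_succ_eval, ← h1, Nat.factorial_succ, ih] at h2
    rw [cc]
    have hf : (n.factorial : ℝ) ≠ 0 := by positivity
    push_cast at h2
    have h3 : ((n:ℝ)+1) * Ring.multichoose (1/2:ℝ) (n+1) = cc n * (1/2 + n) := by
      apply mul_left_cancel₀ hf
      linarith
    field_simp
    linarith

lemma series (y : ℝ) (hy : |y| < 1) :
    HasSum (fun n => cc n * y ^ n) ((1 - y) ^ (-(1:ℝ)/2)) := by
  have h := (Real.one_div_one_sub_rpow_hasFPowerSeriesOnBall_zero (1/2)).hasSum (y := y)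
    (by simpa [enorm_eq_nnnorm] using! hy)
  have hpos : 0 ≤ 1 - y := by linarith [le_abs_self y]
  simp only [FormalMultilinearSeries.ofScalars_apply_eq, cc_eq, zero_add, smul_eq_mul] at h
  rw [neg_div, Real.rpow_neg hpos]
  simpa using h

lemma sin_int (n : ℕ) : ∫ t in (0:ℝ)..(π/2), sin t ^ (2*n) = π/2 * cc n := by
  induction n with
  | zero => simp [cc]
  | succ n ih =>
    rw [mul_add, mul_one, integral_sin_pow, ih, cc]
    simp
    ring

lemma K_series (r : ℝ) (hr : r ∈ Ioo (0:ℝ) 1) :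
    HasSum (fun n => π/2 * (cc n ^ 2 * (r^2) ^ n)) (K r) := by
  have hr2 : r^2 < 1 := by nlinarith [hr.1, hr.2]
  have hr0 : 0 ≤ r^2 := sq_nonneg r
  have h := intervalIntegral.hasSum_integral_of_dominated_convergence (μ := MeasureTheory.volume)
    (a := 0) (b := π/2) (F := fun n t => cc n * (r^2 * sin t ^ 2) ^ n)
    (f := fun t => (1 - r^2 * Real.sin t ^ 2) ^ (-(1:ℝ)/2))
    (fun n _ => (r^2)^n) ?_ ?_ ?_ ?_ ?_
  · have hf : (fun n => π/2 * (cc n ^ 2 * (r^2) ^ n)) =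
        fun n => ∫ t in (0:ℝ)..(π/2), cc n * (r^2 * sin t ^ 2) ^ n := ?_
    · rw [hf]; exact h
    funext n
    simp only [mul_pow, ← pow_mul]
    rw [intervalIntegral.integral_const_mul, intervalIntegral.integral_const_mul, sin_int]
    ring
  · intro n
    apply Continuous.aestronglyMeasurable
    fun_prop
  · intro n
    refine Eventually.of_forall fun t _ => ?_
    have h1 : 0 ≤ r^2 * sin t ^ 2 := by positivity
    have h2 : r^2 * sin t ^ 2 ≤ r^2 := mul_le_of_le_one_right hr0 (sin_sq_le_one t)
    rw [norm_eq_abs, abs_of_nonneg (mul_nonneg (cc_pos n).le (pow_nonneg h1 n))]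
    calc _ ≤ 1 * (r^2)^n := by
          gcongr
          exact cc_le n
      _ = _ := one_mul _
  · exact Eventually.of_forall fun t _ => summable_geometric_of_lt_one hr0 hr2
  · exact intervalIntegrable_const
  · refine Eventually.of_forall fun t _ => series _ ?_
    have h1 : 0 ≤ r^2 * sin t ^ 2 := by positivity
    have h2 : r^2 * sin t ^ 2 ≤ r^2 := mul_le_of_le_one_right hr0 (sin_sq_le_one t)
    rw [abs_of_nonneg h1]; linarith

lemma W_cc (n : ℕ) : Real.Wallis.W n * (cc n ^ 2 * (2*n+1)) = 1 := by
  induction n with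
  | zero => simp [cc, Real.Wallis.W]
  | succ n ih =>
    rw [Real.Wallis.W_succ, cc]
    refine Eq.trans ?_ ih
    push_cast
    field_simp
    ring

lemma cc_bound (n : ℕ) : cc n ^ 2 * (n + 1/4) * π ≤ 1 := by
  have hmono : Monotone (fun n : ℕ => cc n ^ 2 * ((n:ℝ) + 1/4)) := by
    refine monotone_nat_of_le_succ fun n => ?_
    rw [cc, mul_pow, mul_assoc]
    refine mul_le_mul_of_nonneg_left ?_ (sq_nonneg _)
    push_cast
    rw [div_pow, div_mul_eq_mul_div, le_div_iff₀ (by positivity)]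
    nlinarith
  have hlim : Tendsto (fun n : ℕ => cc n ^ 2 * ((n:ℝ) + 1/4)) atTop (𝓝 (1/π)) := by
    have h1 := Real.Wallis.tendsto_W_nhds_pi_div_two.inv₀ (by positivity)
    have h2 : Tendsto (fun n : ℕ => (1/2 : ℝ) - (1/8) * (1 / ((n:ℝ) + 1/2))) atTop
        (𝓝 (1/2 - (1/8) * 0)) := by
      refine tendsto_const_nhds.sub (tendsto_const_nhds.mul ?_)
      refine tendsto_const_nhds.div_atTop ?_
      exact tendsto_atTop_add_const_right _ _ tendsto_natCast_atTop_atTop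
    have h3 := h1.mul h2
    have e : (π/2)⁻¹ * (1/2 - (1/8) * 0) = 1/π := by field_simp; norm_num
    rw [e] at h3
    refine h3.congr fun n => ?_
    have hw := W_cc n
    have : (Real.Wallis.W n)⁻¹ = cc n ^ 2 * (2*n+1) :=
      inv_eq_of_mul_eq_one_right hw
    rw [this]
    field_simp
    ring
  have := hmono.ge_of_tendsto hlim n
  rwa [le_div_iff₀ pi_pos] at this

noncomputable def dd (n : ℕ) : ℝ :=
  π/2 * (16 * cc (n+1) ^ 2 + (5*π - 16) * cc n ^ 2 - 5/(n+1))

lemma dd_neg (n : ℕ) (hn : 1 ≤ n) : dd n < 0 := by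
  have hb := cc_bound n
  have hn' : (1:ℝ) ≤ n := by exact_mod_cast hn
  have hpi := pi_lt_d2
  have hpi3 := pi_gt_three
  unfold dd
  apply mul_neg_of_pos_of_neg (by positivity)
  rw [cc]
  set a := cc n ^ 2 with ha
  have hapos : 0 < a := pow_pos (cc_pos n) 2
  have e : 16 * (cc n * ((2*n+1)/(2*n+2)))^2 + (5*π-16) * a - 5/(n+1)
     = (a * (5*π*(n+1)^2 - (16*n+12)) - 5*(n+1)) / (n+1)^2 := by
    rw [ha]
    field_simp
    ring
  rw [e]
  apply div_neg_of_neg_of_pos _ (by positivity)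
  have h1 : a * (5*π*(n+1)^2 - (16*n+12)) < a * (5 * π * (n+1) * (n+1/4)) := by
    apply mul_lt_mul_of_pos_left _ hapos
    nlinarith
  nlinarith

lemma g₁_series (r : ℝ) (hr : r ∈ Ioo (0:ℝ) 1) :
    HasSum (fun n => dd n * (r^2)^n) (g₁ r - 16 * lam - lam * (5*π-16) * r^2) := by
  have hr2 : r^2 < 1 := by nlinarith [hr.1, hr.2]
  have hr0 : 0 < r^2 := pow_pos hr.1 2
  have hK := K_series r hr
  have hK1 := (hasSum_nat_add_iff' 1).2 hK
  have hL := Real.hasSum_pow_div_log_of_abs_lt_one (x := r^2) (by rwa [abs_of_pos hr0])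
  have h := (((hK1.mul_left 16).add ((hK.mul_left (5*π-16)).mul_right (r^2))).sub
    (hL.mul_left (5*π/2))).mul_right (r^2)⁻¹
  refine Eq.mp (congrArg₂ (fun f v => HasSum (f : ℕ → ℝ) v) ?_ ?_) h
  · funext n
    unfold dd
    have := hr0.ne'
    have hrr := hr.1.ne'
    field_simp
    ring
  · unfold g₁ g
    have hrr := hr.1.ne'
    simp [cc]
    field_simp
    ring

lemma sconv (n : ℕ) (x y a b : ℝ) (hx : 0 < x) (hy : 0 < y) (ha : 0 < a) (hb : 0 < b)
    (hab : a + b = 1) : ((a*x+b*y)^2)^n ≤ a * (x^2)^n + b * (y^2)^n := by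
  simp only [← pow_mul]
  exact (convexOn_pow (2*n)).2 hx.le hy.le ha.le hb.le hab

theorem g₁_strictConcaveOn : StrictConcaveOn ℝ (Ioo (0:ℝ) 1) g₁ := by
  refine ⟨convex_Ioo 0 1, ?_⟩
  intro x hx y hy hxy a b ha hb hab
  have hz := convex_Ioo (0:ℝ) 1 hx hy ha.le hb.le hab
  simp only [smul_eq_mul] at *
  have hsx := g₁_series x hx
  have hsy := g₁_series y hy
  have hsz := g₁_series _ hz
  have hs := (hsx.mul_left a).add (hsy.mul_left b)
  have hlam : 0 < lam := by
    have : Real.log 4 = 2 * Real.log 2 := by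
      rw [show (4:ℝ) = 2^2 by norm_num, Real.log_pow]; norm_num
    unfold lam
    linarith [Real.log_two_lt_d9]
  have hneg : lam * (5*π-16) < 0 :=
    mul_neg_of_pos_of_neg hlam (by linarith [pi_lt_d2])
  have hsq : (a*x+b*y)^2 < a * x^2 + b * y^2 := by
    have e : a * x^2 + b * y^2 - (a*x+b*y)^2 = a * b * (x-y)^2 := by
      obtain rfl : b = 1 - a := by linarith
      ring
    have : 0 < a * b * (x-y)^2 := by
      have := sub_ne_zero.2 hxy
      positivity
    linarith
  have hle := hasSum_le (fun n => ?_) hs hsz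
  · have := mul_lt_mul_of_neg_left hsq hneg
    obtain rfl : b = 1 - a := by linarith
    nlinarith
  · rcases Nat.eq_zero_or_pos n with rfl | hn
    · simp only [pow_zero, mul_one, ← add_mul, hab, one_mul, le_refl]
    · have h1 := dd_neg n hn
      have h2 := sconv n x y a b hx.1 hy.1 ha hb hab
      nlinarith
end
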